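/- For all matrices G, X ∈ ℝ^{n×p}, the tangent component 2·skew(GXᵀ)X and the normal component X(XᵀX − I_p) are orthogonal with respect to the Frobenius inner product: tr((2·skew(GXᵀ)X)ᵀ · X(XᵀX − I_p)) = 0. -/

import Mathlib

open Matrix BigOperators

noncomputable section

/-- Skew-symmetric part of a square matrix. -/
def skewPart {m : ℕ} (A : Matrix (Fin m) (Fin m) ℝ) : Matrix (Fin m) (Fin m) ℝ :=
  (1 / 2 : ℝ) • (A - Aᵀ)

/-- A skew-symmetric and a symmetric matrix are orthogonal in the trace pairing. -/
theorem trace_mul_eq_zero_of_skew_of_symm {ι : Type*} [Fintype ι] {A B : Matrix ι ι ℝ}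
    (hA : Aᵀ = -A) (hB : Bᵀ = B) : Matrix.trace (A * B) = 0 := by
  have h : Matrix.trace (A * B) = -Matrix.trace (A * B) := by
    conv_lhs => rw [← Matrix.trace_transpose, Matrix.transpose_mul, hA, hB, Matrix.mul_neg,
      Matrix.trace_neg, Matrix.trace_mul_comm]
  linarith

theorem transpose_skewPart {m : ℕ} (A : Matrix (Fin m) (Fin m) ℝ) :
    (skewPart A)ᵀ = -skewPart A := by
  simp [skewPart, ← smul_neg]

/-- The tangent component `2 skew(GXᵀ)X` and the normal component `X(XᵀX − I)` are
orthogonal in the Frobenius inner product. -/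
theorem tangent_normal_orthogonal {n p : ℕ} (G X : Matrix (Fin n) (Fin p) ℝ) :
    Matrix.trace (((2 : ℝ) • skewPart (G * Xᵀ) * X)ᵀ * (X * (Xᵀ * X - 1))) = 0 := by
  have hS : ((2 : ℝ) • skewPart (G * Xᵀ))ᵀ = -((2 : ℝ) • skewPart (G * Xᵀ)) := by
    rw [Matrix.transpose_smul, transpose_skewPart, smul_neg]
  have hB : (X * (Xᵀ * X - 1) * Xᵀ)ᵀ = X * (Xᵀ * X - 1) * Xᵀ := by
    simp [Matrix.transpose_mul, Matrix.mul_assoc]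
  rw [Matrix.transpose_mul, hS, Matrix.mul_assoc, Matrix.trace_mul_comm, Matrix.mul_assoc,
    Matrix.neg_mul, Matrix.trace_neg, trace_mul_eq_zero_of_skew_of_symm hS hB, neg_zero]
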